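/- The two equivariant representations agree modulo compact operators: each of the bounded operators π_+(a) − π_−(a) and π_+(b) − π_−(b) is a compact operator on H_h. -/

import Mathlib

noncomputable section

open scoped ComplexConjugate ENNReal InnerProductSpace

/-- Validity predicate for basis indices: the pair `(L, M)` of integers encodes the pair of
half-integers `(l, m) = (L/2, M/2)` with `l ∈ {1/2, 3/2, …}` and `m ∈ {-l, …, l}`. -/
def IdxP (p : ℤ × ℤ) : Prop := 0 < p.1 ∧ Odd p.1 ∧ Odd p.2 ∧ |p.2| ≤ p.1

instance (p : ℤ × ℤ) : Decidable (IdxP p) := Classical.dec _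

/-- The index set of the orthonormal basis `|l,m⟩`; `(L, M)` encodes `l = L/2`, `m = M/2`. -/
abbrev Idx : Type := { p : ℤ × ℤ // IdxP p }

/-- The Hilbert space `H_h`, realized as `ℓ²` over the basis index set. -/
abbrev Hh : Type := lp (fun _ : Idx => ℂ) 2

/-- The basis vector `|l,m⟩` of `H_h` (with `L = 2l`, `M = 2m`), defined to be `0` when the
index is out of the allowed range. -/
def ket (L M : ℤ) : Hh :=
  if h : IdxP (L, M) then lp.single 2 (⟨(L, M), h⟩ : Idx) 1 else 0

/-- The basis vector of `H_h` attached to a valid index. -/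
def ebs (p : Idx) : Hh := lp.single 2 p 1

/-- The `q`-number `[x] = (q^x - q^{-x})/(q - q⁻¹)`. -/
def qn (q x : ℝ) : ℝ := (q ^ x - q ^ (-x)) / (q - q⁻¹)

/-- Coefficient of `|l, m+1⟩` in `π_ε(a)|l,m⟩`. -/
def aC1 (q ε l m : ℝ) : ℝ :=
  ε * (1 + q ^ 2) * (q ^ (m - 1/2) / (qn q (2*l) * qn q (2*l + 2))) *
    Real.sqrt (qn q (l + m + 1) * qn q (l - m))

/-- Coefficient of `|l+1, m+1⟩` in `π_ε(a)|l,m⟩`. -/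
def aC2 (q l m : ℝ) : ℝ :=
  q ^ (m - l - 1/2) / qn q (2*l + 2) * Real.sqrt (qn q (l + m + 1) * qn q (l + m + 2))

/-- Coefficient of `|l-1, m+1⟩` in `π_ε(a)|l,m⟩` (which enters with a minus sign). -/
def aC3 (q l m : ℝ) : ℝ :=
  q ^ (m + l + 1/2) / qn q (2*l) * Real.sqrt (qn q (l - m) * qn q (l - m - 1))

/-- Coefficient of `|l, m⟩` in `π_ε(b)|l,m⟩`. -/
def bC1 (q ε l m : ℝ) : ℝ :=
  ε * ((qn q (l - m + 1) * qn q (l + m) - q ^ 2 * (qn q (l - m) * qn q (l + m + 1))) /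
    (qn q (2*l) * qn q (2*l + 2)))

/-- Coefficient of `|l+1, m⟩` in `π_ε(b)|l,m⟩` (which enters with a minus sign). -/
def bC2 (q l m : ℝ) : ℝ :=
  q ^ (m + 1) / qn q (2*l + 2) * Real.sqrt (qn q (l - m + 1) * qn q (l + m + 1))

/-- Coefficient of `|l-1, m⟩` in `π_ε(b)|l,m⟩` (which enters with a minus sign). -/
def bC3 (q l m : ℝ) : ℝ :=
  q ^ (m + 1) / qn q (2*l) * Real.sqrt (qn q (l - m) * qn q (l + m))

/-- The value of `π_ε(a)` on the basis vector `|l,m⟩` of `H_h`, where `L = 2l`, `M = 2m`. -/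
def aVal (q ε : ℝ) (L M : ℤ) : Hh :=
  ((aC1 q ε (L/2 : ℝ) (M/2 : ℝ) : ℝ) : ℂ) • ket L (M + 2)
    + ((aC2 q (L/2 : ℝ) (M/2 : ℝ) : ℝ) : ℂ) • ket (L + 2) (M + 2)
    - ((aC3 q (L/2 : ℝ) (M/2 : ℝ) : ℝ) : ℂ) • ket (L - 2) (M + 2)

/-- The value of `π_ε(b)` on the basis vector `|l,m⟩` of `H_h`, where `L = 2l`, `M = 2m`. -/
def bVal (q ε : ℝ) (L M : ℤ) : Hh :=
  ((bC1 q ε (L/2 : ℝ) (M/2 : ℝ) : ℝ) : ℂ) • ket L M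
    - ((bC2 q (L/2 : ℝ) (M/2 : ℝ) : ℝ) : ℂ) • ket (L + 2) M
    - ((bC3 q (L/2 : ℝ) (M/2 : ℝ) : ℝ) : ℂ) • ket (L - 2) M

/-- A continuous operator on `ℓ²` whose values on the basis vectors are absolutely summable is
compact. -/
theorem isCompactOperator_of_summable_norm_ebs (T : Hh →L[ℂ] Hh)
    (hT : Summable fun p => ‖T (ebs p)‖) : IsCompactOperator ⇑T := by
  let R : Idx → Hh →L[ℂ] Hh := fun p =>
    (lp.evalCLM ℂ (fun _ : Idx => ℂ) 2 p).smulRight (T (ebs p))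
  have hR_apply (p : Idx) (x : Hh) : R p x = x p • T (ebs p) := rfl
  have hR_norm (p : Idx) : ‖R p‖ ≤ ‖T (ebs p)‖ := by
    refine ContinuousLinearMap.opNorm_le_bound _ (norm_nonneg _) fun x => ?_
    rw [hR_apply, norm_smul, mul_comm]
    gcongr
    exact lp.norm_apply_le_norm two_ne_zero x p
  have hR_sum : Summable R := Summable.of_norm_bounded hT hR_norm
  have hT_eq : HasSum R T := by
    convert hR_sum.hasSum
    ext1 x
    have h1 : HasSum (fun p => R p x) (T x) := by
      have h := (lp.hasSum_single (p := 2) (by simp) x).mapL T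
      convert h using 2 with p
      rw [hR_apply, ← map_smul, ebs, ← lp.single_smul]
      simp
    exact h1.unique (hR_sum.hasSum.mapL (ContinuousLinearMap.apply ℂ Hh x))
  refine isCompactOperator_of_tendsto hT_eq (Filter.Eventually.of_forall fun s => ?_)
  refine (compactOperator (RingHom.id ℂ) Hh Hh).sum_mem fun p _ => ?_
  exact ((isCompactOperator_id (E := ℂ)).comp_clm
    (lp.evalCLM ℂ (fun _ : Idx => ℂ) 2 p)).continuous_comp
      (g := fun c => c • T (ebs p)) (by fun_prop)

theorem summable_pow_natAbs {r : ℝ} (hr0 : 0 ≤ r) (hr1 : r < 1) :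
    Summable fun n : ℤ => r ^ n.natAbs :=
  Summable.of_nat_of_neg (by simpa using summable_geometric_of_lt_one hr0 hr1)
    (by simpa using summable_geometric_of_lt_one hr0 hr1)

theorem summable_rpow_idx {q : ℝ} (hq0 : 0 < q) (hq1 : q < 1) :
    Summable fun p : Idx => q ^ (p.1.1 : ℝ) := by
  set r := √q with hr
  have hr0 : 0 < r := Real.sqrt_pos.2 hq0
  have hr1 : r < 1 := by rw [hr, Real.sqrt_lt' one_pos]; simpa using hq1
  have hs := summable_pow_natAbs hr0.le hr1
  have hprod : Summable fun x : ℤ × ℤ => r ^ x.1.natAbs * r ^ x.2.natAbs :=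
    hs.mul_of_nonneg hs (fun _ => by positivity) (fun _ => by positivity)
  refine Summable.of_nonneg_of_le (fun p => by positivity) (fun p => ?_)
    (hprod.comp_injective Subtype.val_injective)
  obtain ⟨⟨L, M⟩, hL, -, -, hM⟩ := p
  simp only [Function.comp_apply] at hL hM ⊢
  lift L to ℕ using hL.le
  have hML : M.natAbs ≤ L := by rw [Int.abs_eq_natAbs] at hM; exact_mod_cast hM
  have hqr : q = r * r := (Real.mul_self_sqrt hq0.le).symm
  calc q ^ (((L : ℕ) : ℤ) : ℝ) = r ^ L * r ^ L := by
        rw [Int.cast_natCast, Real.rpow_natCast, hqr, mul_pow]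
    _ ≤ r ^ L * r ^ M.natAbs := by
        gcongr r ^ L * ?_
        exact pow_le_pow_of_le_one hr0.le hr1.le hML

theorem norm_ket_le_one (L M : ℤ) : ‖ket L M‖ ≤ 1 := by
  unfold ket
  split_ifs
  · rw [lp.norm_single two_pos]; simp
  · simp

theorem inv_sub_self_pos {q : ℝ} (hq0 : 0 < q) (hq1 : q < 1) : 0 < q⁻¹ - q :=
  sub_pos.2 (hq1.trans ((one_lt_inv₀ hq0).2 hq1))

theorem qn_eq (q x : ℝ) : qn q x = (q ^ (-x) - q ^ x) / (q⁻¹ - q) := by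
  rw [qn, ← neg_sub (q ^ (-x)), ← neg_sub q⁻¹, neg_div_neg_eq]

theorem qn_nonneg {q x : ℝ} (hq0 : 0 < q) (hq1 : q < 1) (hx : 0 ≤ x) : 0 ≤ qn q x := by
  rw [qn_eq]
  refine div_nonneg (sub_nonneg.2 ?_) (inv_sub_self_pos hq0 hq1).le
  exact Real.rpow_le_rpow_of_exponent_ge hq0 hq1.le (by linarith)

theorem qn_le {q : ℝ} (hq0 : 0 < q) (hq1 : q < 1) (x : ℝ) :
    qn q x ≤ q ^ (-x) / (q⁻¹ - q) := by
  have := inv_sub_self_pos hq0 hq1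
  rw [qn_eq]
  gcongr
  linarith [Real.rpow_pos_of_pos hq0 x]

theorem rpow_le_qn {q x : ℝ} (hq0 : 0 < q) (hq1 : q < 1) (hx : 1 ≤ x) :
    q ^ (1 - x) ≤ qn q x := by
  rw [qn_eq, le_div_iff₀ (inv_sub_self_pos hq0 hq1)]
  have h1 : q ^ (1 - x) * q⁻¹ = q ^ (-x) := by
    rw [← Real.rpow_neg_one q, ← Real.rpow_add hq0]; ring_nf
  have h2 : q ^ x ≤ q ^ (1 - x) * q := by
    nth_rewrite 3 [← Real.rpow_one q]
    rw [← Real.rpow_add hq0]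
    exact Real.rpow_le_rpow_of_exponent_ge hq0 hq1.le (by linarith)
  linarith

theorem qn_mul_qn_le {q x y : ℝ} (hq0 : 0 < q) (hq1 : q < 1) (hx : 0 ≤ x) :
    qn q x * qn q y ≤ q ^ (-(x + y)) / (q⁻¹ - q) ^ 2 := by
  have := inv_sub_self_pos hq0 hq1
  calc qn q x * qn q y ≤ qn q x * (q ^ (-y) / (q⁻¹ - q)) :=
        mul_le_mul_of_nonneg_left (qn_le hq0 hq1 y) (qn_nonneg hq0 hq1 hx)
    _ ≤ q ^ (-x) / (q⁻¹ - q) * (q ^ (-y) / (q⁻¹ - q)) := by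
        gcongr
        exact qn_le hq0 hq1 x
    _ = _ := by rw [neg_add, Real.rpow_add hq0, div_mul_div_comm, sq]

theorem rpow_le_qn_mul_qn {q l : ℝ} (hq0 : 0 < q) (hq1 : q < 1) (hl : 1 ≤ 2 * l) :
    q ^ (-(4 * l)) ≤ qn q (2 * l) * qn q (2 * l + 2) := by
  calc q ^ (-(4 * l)) = q ^ (1 - 2 * l) * q ^ (1 - (2 * l + 2)) := by
        rw [← Real.rpow_add hq0]; ring_nf
    _ ≤ _ := by
        gcongr
        · exact qn_nonneg hq0 hq1 (by linarith)
        · exact rpow_le_qn hq0 hq1 hl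
        · exact rpow_le_qn hq0 hq1 (by linarith)

theorem abs_aC1_le {q l m : ℝ} (hq0 : 0 < q) (hq1 : q < 1) (hl : 1 ≤ 2 * l) (hm : |m| ≤ l) :
    |aC1 q 1 l m| ≤ (1 + q ^ 2) * (q⁻¹ / (q⁻¹ - q)) * q ^ (2 * l) := by
  have hδ := inv_sub_self_pos hq0 hq1
  obtain ⟨hm1, hm2⟩ := abs_le.1 hm
  have hden := rpow_le_qn_mul_qn hq0 hq1 hl
  have hden0 : 0 < qn q (2 * l) * qn q (2 * l + 2) := (Real.rpow_pos_of_pos hq0 _).trans_le hden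
  have hsqrt : √(qn q (l + m + 1) * qn q (l - m)) ≤ q ^ (-(l + 1 / 2)) / (q⁻¹ - q) := by
    refine Real.sqrt_le_iff.2 ⟨by positivity, (qn_mul_qn_le hq0 hq1 (by linarith)).trans_eq ?_⟩
    rw [div_pow, ← Real.rpow_mul_natCast hq0.le]
    push_cast
    ring_nf
  have hexp : q ^ (m - 1 / 2) / q ^ (-(4 * l)) * q ^ (-(l + 1 / 2)) ≤ q⁻¹ * q ^ (2 * l) := by
    rw [← Real.rpow_sub hq0, ← Real.rpow_add hq0, ← Real.rpow_neg_one q, ← Real.rpow_add hq0]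
    exact Real.rpow_le_rpow_of_exponent_ge hq0 hq1.le (by linarith)
  rw [aC1, one_mul, abs_of_nonneg (by positivity)]
  calc (1 + q ^ 2) * (q ^ (m - 1 / 2) / (qn q (2 * l) * qn q (2 * l + 2))) *
        √(qn q (l + m + 1) * qn q (l - m))
      ≤ (1 + q ^ 2) * (q ^ (m - 1 / 2) / q ^ (-(4 * l))) *
        (q ^ (-(l + 1 / 2)) / (q⁻¹ - q)) := by gcongr
    _ = (1 + q ^ 2) * (q ^ (m - 1 / 2) / q ^ (-(4 * l)) * q ^ (-(l + 1 / 2))) / (q⁻¹ - q) := by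
        ring
    _ ≤ (1 + q ^ 2) * (q⁻¹ * q ^ (2 * l)) / (q⁻¹ - q) := by gcongr
    _ = _ := by ring

theorem abs_bC1_le {q l m : ℝ} (hq0 : 0 < q) (hq1 : q < 1) (hl : 1 ≤ 2 * l) (hm : |m| ≤ l) :
    |bC1 q 1 l m| ≤ (1 + q ^ 2) * (q⁻¹ / (q⁻¹ - q) ^ 2) * q ^ (2 * l) := by
  have hδ := inv_sub_self_pos hq0 hq1
  obtain ⟨hm1, hm2⟩ := abs_le.1 hm
  have hden := rpow_le_qn_mul_qn hq0 hq1 hl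
  have hden0 : 0 < qn q (2 * l) * qn q (2 * l + 2) := (Real.rpow_pos_of_pos hq0 _).trans_le hden
  have h1 := qn_mul_qn_le (y := l + m) hq0 hq1 (show 0 ≤ l - m + 1 by linarith)
  have h2 := qn_mul_qn_le (y := l + m + 1) hq0 hq1 (show 0 ≤ l - m by linarith)
  rw [show l - m + 1 + (l + m) = 2 * l + 1 by ring] at h1
  rw [show l - m + (l + m + 1) = 2 * l + 1 by ring] at h2
  have h1' : 0 ≤ qn q (l - m + 1) * qn q (l + m) :=
    mul_nonneg (qn_nonneg hq0 hq1 (by linarith)) (qn_nonneg hq0 hq1 (by linarith))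
  have h2' : 0 ≤ qn q (l - m) * qn q (l + m + 1) :=
    mul_nonneg (qn_nonneg hq0 hq1 (by linarith)) (qn_nonneg hq0 hq1 (by linarith))
  have hnum : |qn q (l - m + 1) * qn q (l + m) - q ^ 2 * (qn q (l - m) * qn q (l + m + 1))| ≤
      (1 + q ^ 2) * (q ^ (-(2 * l + 1)) / (q⁻¹ - q) ^ 2) := by
    have h3 := mul_le_mul_of_nonneg_left h2 (sq_nonneg q)
    have h3' := mul_nonneg (sq_nonneg q) h2'
    have h4 := mul_nonneg (sq_nonneg q) (h2'.trans h2)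
    rw [abs_le]
    constructor <;> linarith
  have hexp : q ^ (-(2 * l + 1)) / q ^ (-(4 * l)) = q⁻¹ * q ^ (2 * l) := by
    rw [← Real.rpow_sub hq0, ← Real.rpow_neg_one q, ← Real.rpow_add hq0]
    ring_nf
  rw [bC1, one_mul, abs_div, abs_of_pos hden0]
  calc _ ≤ (1 + q ^ 2) * (q ^ (-(2 * l + 1)) / (q⁻¹ - q) ^ 2) / q ^ (-(4 * l)) := by gcongr
    _ = (1 + q ^ 2) * (q ^ (-(2 * l + 1)) / q ^ (-(4 * l))) / (q⁻¹ - q) ^ 2 := by ring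
    _ = _ := by rw [hexp]; ring

theorem aVal_sub_aVal (q : ℝ) (L M : ℤ) :
    aVal q 1 L M - aVal q (-1) L M = ((2 * aC1 q 1 (L/2) (M/2) : ℝ) : ℂ) • ket L (M + 2) := by
  have h : aC1 q (-1) (L/2) (M/2) = -aC1 q 1 (L/2) (M/2) := by simp only [aC1]; ring
  rw [aVal, aVal, h]
  push_cast
  module

theorem bVal_sub_bVal (q : ℝ) (L M : ℤ) :
    bVal q 1 L M - bVal q (-1) L M = ((2 * bC1 q 1 (L/2) (M/2) : ℝ) : ℂ) • ket L M := by
  have h : bC1 q (-1) (L/2) (M/2) = -bC1 q 1 (L/2) (M/2) := by simp only [bC1]; ring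
  rw [bVal, bVal, h]
  push_cast
  module

theorem norm_two_mul_smul_ket_le {c B : ℝ} (h : |c| ≤ B) (L M : ℤ) :
    ‖((2 * c : ℝ) : ℂ) • ket L M‖ ≤ 2 * B := by
  rw [norm_smul, Complex.norm_real, Real.norm_eq_abs, abs_mul, abs_two]
  calc 2 * |c| * ‖ket L M‖ ≤ 2 * |c| * 1 := by gcongr; exact norm_ket_le_one L M
    _ ≤ 2 * B := by linarith

theorem Idx.one_le_two_mul_half (p : Idx) : (1 : ℝ) ≤ 2 * ((p.1.1 : ℝ) / 2) := by
  have h : 0 < p.1.1 := p.2.1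
  rw [mul_div_cancel₀ _ two_ne_zero]
  exact_mod_cast h

theorem Idx.abs_half_le_half (p : Idx) : |(p.1.2 : ℝ) / 2| ≤ (p.1.1 : ℝ) / 2 := by
  have h : |(p.1.2 : ℝ)| ≤ p.1.1 := by exact_mod_cast p.2.2.2.2
  rw [abs_div, abs_two]
  gcongr

/-- The two equivariant representations agree modulo compact operators:
`π₊(a) - π₋(a)` and `π₊(b) - π₋(b)` are compact operators on `H_h`. -/
theorem statement8 (q : ℝ) (hq0 : 0 < q) (hq1 : q < 1)
    (Ap Am Bp Bm : Hh →L[ℂ] Hh)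
    (hAp : ∀ p : Idx, Ap (ebs p) = aVal q 1 p.1.1 p.1.2)
    (hAm : ∀ p : Idx, Am (ebs p) = aVal q (-1) p.1.1 p.1.2)
    (hBp : ∀ p : Idx, Bp (ebs p) = bVal q 1 p.1.1 p.1.2)
    (hBm : ∀ p : Idx, Bm (ebs p) = bVal q (-1) p.1.1 p.1.2) :
    IsCompactOperator ⇑(Ap - Am) ∧ IsCompactOperator ⇑(Bp - Bm) := by
  refine ⟨isCompactOperator_of_summable_norm_ebs _ ?_, isCompactOperator_of_summable_norm_ebs _ ?_⟩
  · refine Summable.of_nonneg_of_le (fun _ => norm_nonneg _) (fun p => ?_)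
      (((summable_rpow_idx hq0 hq1).mul_left ((1 + q ^ 2) * (q⁻¹ / (q⁻¹ - q)))).mul_left 2)
    have h := abs_aC1_le hq0 hq1 p.one_le_two_mul_half p.abs_half_le_half
    rw [mul_div_cancel₀ _ two_ne_zero] at h
    rw [sub_apply, hAp, hAm, aVal_sub_aVal]
    exact norm_two_mul_smul_ket_le h _ _
  · refine Summable.of_nonneg_of_le (fun _ => norm_nonneg _) (fun p => ?_)
      (((summable_rpow_idx hq0 hq1).mul_left ((1 + q ^ 2) * (q⁻¹ / (q⁻¹ - q) ^ 2))).mul_left 2)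
    have h := abs_bC1_le hq0 hq1 p.one_le_two_mul_half p.abs_half_le_half
    rw [mul_div_cancel₀ _ two_ne_zero] at h
    rw [sub_apply, hBp, hBm, bVal_sub_bVal]
    exact norm_two_mul_smul_ket_le h _ _
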